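/- arXiv:2007.06128 — 11 statements merged into one kernel-verified Lean document; each statement's English description precedes it below -/
import Mathlib

section
/- Let L be a vector lattice and let f ↦ f* be a map sending each element of L⁺ to an element of L⁺. Then the condition (a): f ∧ g* ≤ f* ≤ f for all f, g ∈ L⁺, holds if and only if the condition (a'): f ∧ g* = f* ∧ g for all f, g ∈ L⁺, holds. -/
/-- For a map sending positive elements of a vector lattice to positive elements,
condition (a): `f ⊓ g* ≤ f* ≤ f` for all `f, g ∈ L⁺`, holds iff
condition (a'): `f ⊓ g* = f* ⊓ g` for all `f, g ∈ L⁺`, holds. -/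
theorem stmt_0 {L : Type*} [Lattice L] [AddCommGroup L]
    [CovariantClass L L (· + ·) (· ≤ ·)] [Module ℝ L] [PosSMulMono ℝ L]
    (t : L → L) (ht : ∀ f : L, 0 ≤ f → 0 ≤ t f) :
    (∀ f g : L, 0 ≤ f → 0 ≤ g → f ⊓ t g ≤ t f ∧ t f ≤ f) ↔
      (∀ f g : L, 0 ≤ f → 0 ≤ g → f ⊓ t g = t f ⊓ g) := by
  constructor
  · intro h f g hf hg
    apply le_antisymm
    · exact le_inf (h f g hf hg).1 (inf_le_right.trans (h g f hg hf).2)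
    · refine le_inf (inf_le_left.trans (h f g hf hg).2) ?_
      rw [inf_comm]
      exact (h g f hg hf).1
  · intro h f g hf hg
    refine ⟨(h f g hf hg).trans_le inf_le_left, ?_⟩
    have key : f ⊓ t (t f) = t f := by
      rw [h f (t f) hf (ht f hf), inf_idem]
    exact key.ge.trans inf_le_left
end

section
/- Let * be a truncation on a vector lattice L and let f, g ∈ L⁺. Then (f ∧ g)* = f* ∧ g*. -/
/-- A truncation on a vector lattice `L`: a map sending each positive element to a
positive element, not identically zero on the positive cone, satisfying
(a) `f ⊓ g* ≤ f* ≤ f` for all `f, g ∈ L⁺`, and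
(b) if `f ∈ L⁺` and `(n • f)* = n • f` for all `n ≥ 1`, then `f = 0`. -/
structure Truncation (L : Type*) [Lattice L] [AddCommGroup L] where
  toFun : L → L
  map_nonneg' : ∀ f : L, 0 ≤ f → 0 ≤ toFun f
  nonzero' : ∃ f : L, 0 ≤ f ∧ toFun f ≠ 0
  inf_le' : ∀ f g : L, 0 ≤ f → 0 ≤ g → f ⊓ toFun g ≤ toFun f
  le_self' : ∀ f : L, 0 ≤ f → toFun f ≤ f
  arch' : ∀ f : L, 0 ≤ f → (∀ n : ℕ, 1 ≤ n → toFun (n • f) = n • f) → f = 0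

/-- If `*` is a truncation on a vector lattice `L` and `f, g ∈ L⁺`,
then `(f ⊓ g)* = f* ⊓ g*`. -/
theorem stmt_1 {L : Type*} [Lattice L] [AddCommGroup L]
    [CovariantClass L L (· + ·) (· ≤ ·)] [Module ℝ L] [PosSMulMono ℝ L]
    (t : Truncation L) (f g : L) (hf : 0 ≤ f) (hg : 0 ≤ g) :
    t.toFun (f ⊓ g) = t.toFun f ⊓ t.toFun g := by
  have h_inf : 0 ≤ f ⊓ g := le_inf hf hg
  have h_le : t.toFun (f ⊓ g) ≤ f ⊓ g := t.le_self' _ h_inf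
  refine le_antisymm (le_inf ?_ ?_) ?_
  · exact (le_inf (h_le.trans inf_le_left) le_rfl).trans (t.inf_le' f (f ⊓ g) hf h_inf)
  · exact (le_inf (h_le.trans inf_le_right) le_rfl).trans (t.inf_le' g (f ⊓ g) hg h_inf)
  · exact (le_inf (inf_le_inf (t.le_self' f hf) (t.le_self' g hg)) inf_le_left).trans
      (t.inf_le' (f ⊓ g) f h_inf hf)
end

section
/- Let * be a truncation on a vector lattice L and let f, g ∈ L⁺. Then |f* − g*| ≤ |f − g|*. -/
namespace Truncation

variable {L : Type*} [Lattice L] [AddCommGroup L] (t : Truncation L)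

theorem toFun_eq_inf_of_le {f h : L} (hf : 0 ≤ f) (hfh : f ≤ h) :
    t.toFun f = f ⊓ t.toFun h := by
  have hh := hf.trans hfh
  have hle : t.toFun f ≤ f := t.le_self' f hf
  have hmono : t.toFun f ≤ t.toFun h :=
    (le_inf (hle.trans hfh) le_rfl).trans (t.inf_le' h f hh hf)
  exact le_antisymm (le_inf hle hmono) (t.inf_le' f h hf hh)

end Truncation

/-- If `*` is a truncation on a vector lattice `L` and `f, g ∈ L⁺`,
then `|f* - g*| ≤ |f - g|*`. -/
theorem stmt_3 {L : Type*} [Lattice L] [AddCommGroup L]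
    [CovariantClass L L (· + ·) (· ≤ ·)] [Module ℝ L] [PosSMulMono ℝ L]
    (t : Truncation L) (f g : L) (hf : 0 ≤ f) (hg : 0 ≤ g) :
    |t.toFun f - t.toFun g| ≤ t.toFun |f - g| := by
  have : AddLeftMono L := ‹CovariantClass L L (· + ·) (· ≤ ·)›
  have hf' := t.toFun_eq_inf_of_le hf (le_sup_left : f ≤ f ⊔ g)
  have hg' := t.toFun_eq_inf_of_le hg (le_sup_right : g ≤ f ⊔ g)
  have hbound : |t.toFun f - t.toFun g| ≤ t.toFun (f ⊔ g) := by
    refine abs_le'.2 ⟨?_, ?_⟩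
    · exact (sub_le_self _ (t.map_nonneg' g hg)).trans (hf'.trans_le inf_le_right)
    · rw [neg_sub]
      exact (sub_le_self _ (t.map_nonneg' f hf)).trans (hg'.trans_le inf_le_right)
  have hdiff : |t.toFun f - t.toFun g| ≤ |f - g| := by
    rw [hf', hg']
    exact abs_inf_sub_inf_le_abs f g _
  exact (le_inf hdiff hbound).trans
    (t.inf_le' _ _ (abs_nonneg _) (hf.trans le_sup_left))
end

section
/- Let * be a truncation on a vector lattice L, let P be a proper prime ideal of L, and let f, g ∈ L⁺. If f − f* ∉ P, then g* − (g ∧ f*) ∈ P. -/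
/-- An (order) ideal of a vector lattice: a vector subspace which is solid. -/
def IsLatticeIdeal {L : Type*} [Lattice L] [AddCommGroup L] [Module ℝ L]
    (P : Submodule ℝ L) : Prop :=
  ∀ f ∈ P, ∀ g : L, |g| ≤ |f| → g ∈ P

/-- A proper prime ideal of a vector lattice: a solid vector subspace `P ≠ L`
such that `f ⊓ g ∈ P` implies `f ∈ P` or `g ∈ P`. -/
def IsProperPrimeIdeal {L : Type*} [Lattice L] [AddCommGroup L] [Module ℝ L]
    (P : Submodule ℝ L) : Prop :=
  IsLatticeIdeal P ∧ P ≠ ⊤ ∧ ∀ f g : L, f ⊓ g ∈ P → f ∈ P ∨ g ∈ P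

/-- Let `*` be a truncation on a vector lattice `L`, `P` a proper prime ideal of `L`,
and `f, g ∈ L⁺`. If `f - f* ∉ P` then `g* - (g ⊓ f*) ∈ P`. -/
theorem stmt_4 {L : Type*} [Lattice L] [AddCommGroup L]
    [CovariantClass L L (· + ·) (· ≤ ·)] [Module ℝ L] [PosSMulMono ℝ L]
    (t : Truncation L) (P : Submodule ℝ L) (hP : IsProperPrimeIdeal P)
    (f g : L) (hf : 0 ≤ f) (hg : 0 ≤ g)
    (h : f - t.toFun f ∉ P) :
    t.toFun g - (g ⊓ t.toFun f) ∈ P := by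
  have : IsOrderedAddMonoid L :=
    { add_le_add_left := fun a b hab c => by
        rw [add_comm a c, add_comm b c]
        exact CovariantClass.elim c hab }
  have hinf : (f - t.toFun f) ⊓ (t.toFun g - g ⊓ t.toFun f) = 0 := by
    apply le_antisymm
    · set w := (f - t.toFun f) ⊓ (t.toFun g - g ⊓ t.toFun f)
      have hwf : w + g ⊓ t.toFun f ≤ f :=
        (add_le_add le_rfl inf_le_right).trans (le_sub_iff_add_le.mp inf_le_left)
      have hwg : w + g ⊓ t.toFun f ≤ t.toFun g := le_sub_iff_add_le.mp inf_le_right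
      have hw : w + g ⊓ t.toFun f ≤ g ⊓ t.toFun f :=
        le_inf (hwg.trans (t.le_self' g hg)) ((le_inf hwf hwg).trans (t.inf_le' f g hf hg))
      exact add_le_iff_nonpos_left.mp hw
    · exact le_inf (sub_nonneg.mpr (t.le_self' f hf)) (sub_nonneg.mpr (t.inf_le' g f hg hf))
  exact (hP.2.2 _ _ (hinf ▸ P.zero_mem)).resolve_left h
end

section
/- Let * be a truncation on a vector lattice L, let P be a proper prime ideal of L, and let f, g ∈ L⁺. If (f − f*)* ∧ (g − g*)* ∉ P, then f* − g* ∈ P. -/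
/-- In a vector lattice, truncation forces `f - f*` to be disjoint from `(g* - f*)⁺`. -/
theorem Truncation.sub_inf_sup_zero_eq_zero {L : Type*} [Lattice L] [AddCommGroup L]
    [CovariantClass L L (· + ·) (· ≤ ·)] (t : Truncation L) {f g : L} (hf : 0 ≤ f) (hg : 0 ≤ g) :
    (f - t.toFun f) ⊓ ((t.toFun g - t.toFun f) ⊔ 0) = 0 := by
  let _ : AddLeftMono L := ‹_›
  let _ : DistribLattice L := AddCommGroup.toDistribLattice L
  have hle : t.toFun f ≤ f := t.le_self' f hf
  have hmeet : (f - t.toFun f) ⊓ (t.toFun g - t.toFun f) ≤ 0 := by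
    rw [← inf_sub]
    exact sub_nonpos.2 (t.inf_le' f g hf hg)
  rw [inf_sup_left, inf_eq_right.2 (sub_nonneg.2 hle)]
  exact sup_eq_right.2 hmeet

/-- A lattice ideal contains every element between `0` and one of its members. -/
theorem IsLatticeIdeal.mem_of_nonneg_of_le {L : Type*} [Lattice L] [AddCommGroup L]
    [AddLeftMono L] [Module ℝ L] {P : Submodule ℝ L} (hP : IsLatticeIdeal P) {a b : L}
    (ha : 0 ≤ a) (hab : a ≤ b) (hb : b ∈ P) : a ∈ P :=
  hP b hb a (by rwa [abs_of_nonneg ha, abs_of_nonneg (ha.trans hab)])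

/-- If `f - f*` lies outside a prime ideal `P`, then `(g* - f*)⁺` lies in `P`. -/
theorem Truncation.sub_sup_zero_mem {L : Type*} [Lattice L] [AddCommGroup L]
    [CovariantClass L L (· + ·) (· ≤ ·)] [Module ℝ L] (t : Truncation L) {P : Submodule ℝ L}
    (hP : IsProperPrimeIdeal P) {f g : L} (hf : 0 ≤ f) (hg : 0 ≤ g) (h : f - t.toFun f ∉ P) :
    (t.toFun g - t.toFun f) ⊔ 0 ∈ P := by
  refine (hP.2.2 (f - t.toFun f) _ ?_).resolve_left h
  rw [t.sub_inf_sup_zero_eq_zero hf hg]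
  exact P.zero_mem


/-- Let `*` be a truncation on a vector lattice `L`, `P` a proper prime ideal of `L`,
and `f, g ∈ L⁺`. If `(f - f*)* ⊓ (g - g*)* ∉ P` then `f* - g* ∈ P`. -/
theorem stmt_5 {L : Type*} [Lattice L] [AddCommGroup L]
    [CovariantClass L L (· + ·) (· ≤ ·)] [Module ℝ L] [PosSMulMono ℝ L]
    (t : Truncation L) (P : Submodule ℝ L) (hP : IsProperPrimeIdeal P)
    (f g : L) (hf : 0 ≤ f) (hg : 0 ≤ g)
    (h : t.toFun (f - t.toFun f) ⊓ t.toFun (g - t.toFun g) ∉ P) :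
    t.toFun f - t.toFun g ∈ P := by
  let _ : AddLeftMono L := ‹_›
  have hf' : 0 ≤ f - t.toFun f := sub_nonneg.2 (t.le_self' f hf)
  have hg' : 0 ≤ g - t.toFun g := sub_nonneg.2 (t.le_self' g hg)
  have hmeet : 0 ≤ t.toFun (f - t.toFun f) ⊓ t.toFun (g - t.toFun g) :=
    le_inf (t.map_nonneg' _ hf') (t.map_nonneg' _ hg')
  have hfP : f - t.toFun f ∉ P := fun hmem =>
    h (hP.1.mem_of_nonneg_of_le hmeet (inf_le_left.trans (t.le_self' _ hf')) hmem)
  have hgP : g - t.toFun g ∉ P := fun hmem =>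
    h (hP.1.mem_of_nonneg_of_le hmeet (inf_le_right.trans (t.le_self' _ hg')) hmem)
  have hsub := P.sub_mem (t.sub_sup_zero_mem hP hg hf hgP) (t.sub_sup_zero_mem hP hf hg hfP)
  have hparts := posPart_sub_negPart (t.toFun f - t.toFun g)
  rw [posPart_def, negPart_def, neg_sub] at hparts
  rwa [hparts] at hsub
end

section
/- Let * be a truncation on a vector lattice L, let P be a proper prime ideal of L, and let f ∈ L⁺. Then f* ∈ P if and only if (n f)* ∈ P for all integers n ≥ 1. -/
/-- Let `*` be a truncation on a vector lattice `L`, `P` a proper prime ideal of `L`,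
and `f ∈ L⁺`. Then `f* ∈ P` iff `(n • f)* ∈ P` for all integers `n ≥ 1`. -/
theorem stmt_6 {L : Type*} [Lattice L] [AddCommGroup L]
    [CovariantClass L L (· + ·) (· ≤ ·)] [Module ℝ L] [PosSMulMono ℝ L]
    (t : Truncation L) (P : Submodule ℝ L) (hP : IsProperPrimeIdeal P)
    (f : L) (hf : 0 ≤ f) :
    t.toFun f ∈ P ↔ ∀ n : ℕ, 1 ≤ n → t.toFun (n • f) ∈ P := by
  obtain ⟨hI, -, hprime⟩ := hP
  refine ⟨fun h n _ => ?_, fun h => by simpa using h 1 le_rfl⟩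
  have hnf : 0 ≤ n • f := nsmul_nonneg hf n
  have hinf : f ⊓ t.toFun (n • f) ∈ P :=
    hI.mem_of_nonneg_of_le (le_inf hf (t.map_nonneg' _ hnf)) (t.inf_le' f _ hf hnf) h
  rcases hprime _ _ hinf with hfP | hmem
  · exact hI.mem_of_nonneg_of_le (t.map_nonneg' _ hnf) (t.le_self' _ hnf) (P.nsmul_mem hfP n)
  · exact hmem
end

section
/- Let * be a truncation on a vector lattice L, let P be a proper prime ideal of L, let u, v ∈ π*(P), and let f ∈ L. Then for every real number α: (f − α u*)⁺ ∈ P if and only if (f − α v*)⁺ ∈ P; in other words, {α ∈ ℝ : (f − α u*)⁺ ∈ P} = {α ∈ ℝ : (f − α v*)⁺ ∈ P}. -/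
section TruncationModPrime

variable {L : Type*} [Lattice L] [AddCommGroup L] [CovariantClass L L (· + ·) (· ≤ ·)]

theorem Truncation.sub_inf_posPart_eq_zero (t : Truncation L) {u v : L} (hu : 0 ≤ u) (hv : 0 ≤ v) :
    (u - t.toFun u) ⊓ ((t.toFun v - t.toFun u) ⊔ 0) = 0 := by
  let _ : DistribLattice L := AddCommGroup.toDistribLattice L
  have hnonneg : 0 ≤ u - t.toFun u := sub_nonneg.2 (t.le_self' u hu)
  have hle : (u - t.toFun u) ⊓ (t.toFun v - t.toFun u) ≤ 0 := by
    rw [← inf_sub]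
    exact sub_nonpos.2 (t.inf_le' u v hu hv)
  rw [inf_sup_left, inf_eq_right.2 hnonneg]
  exact sup_eq_right.2 hle

variable [Module ℝ L] {P : Submodule ℝ L}

theorem IsLatticeIdeal.mem_of_nonneg_of_le_s8 (hP : IsLatticeIdeal P) {f g : L} (hf : f ∈ P)
    (hg : 0 ≤ g) (hgf : g ≤ f) : g ∈ P :=
  hP f hf g (by rwa [abs_of_nonneg hg, abs_of_nonneg (hg.trans hgf)])

theorem IsLatticeIdeal.sup_mem_iff_of_sub_mem (hP : IsLatticeIdeal P) {f g : L}
    (h : f - g ∈ P) : f ⊔ 0 ∈ P ↔ g ⊔ 0 ∈ P := by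
  have hsub : f ⊔ 0 - g ⊔ 0 ∈ P := hP _ h _ (abs_sup_sub_sup_le_abs f g 0)
  exact ⟨fun hf => by simpa using P.sub_mem hf hsub, fun hg => by simpa using P.add_mem hsub hg⟩

theorem Truncation.posPart_sub_mem (t : Truncation L) (hP : IsProperPrimeIdeal P) {u v : L}
    (hu : 0 ≤ u) (hv : 0 ≤ v) (hu' : t.toFun (u - t.toFun u) ∉ P) :
    (t.toFun v - t.toFun u) ⊔ 0 ∈ P := by
  have hnonneg : 0 ≤ u - t.toFun u := sub_nonneg.2 (t.le_self' u hu)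
  refine (hP.2.2 (u - t.toFun u) _ ?_).resolve_left fun h =>
    hu' (hP.1.mem_of_nonneg_of_le_s8 h (t.map_nonneg' _ hnonneg) (t.le_self' _ hnonneg))
  rw [t.sub_inf_posPart_eq_zero hu hv]
  exact P.zero_mem

theorem Truncation.sub_mem (t : Truncation L) (hP : IsProperPrimeIdeal P) {u v : L}
    (hu : 0 ≤ u) (hv : 0 ≤ v) (hu' : t.toFun (u - t.toFun u) ∉ P)
    (hv' : t.toFun (v - t.toFun v) ∉ P) : t.toFun v - t.toFun u ∈ P := by
  have h := P.sub_mem (t.posPart_sub_mem hP hu hv hu') (t.posPart_sub_mem hP hv hu hv')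
  rwa [← neg_sub (t.toFun v) (t.toFun u), ← posPart_def, ← negPart_def,
    posPart_sub_negPart] at h

end TruncationModPrime

/-- Let `*` be a truncation on a vector lattice `L`, `P` a proper prime ideal of `L`,
`u, v ∈ π*(P)` (i.e. `u, v ∈ L⁺` with `(u - u*)* ∉ P` and `(v - v*)* ∉ P`), and `f ∈ L`.
Then `{α ∈ ℝ : (f - α • u*)⁺ ∈ P} = {α ∈ ℝ : (f - α • v*)⁺ ∈ P}`. -/
theorem stmt_8 {L : Type*} [Lattice L] [AddCommGroup L]
    [CovariantClass L L (· + ·) (· ≤ ·)] [Module ℝ L] [PosSMulMono ℝ L]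
    (t : Truncation L) (P : Submodule ℝ L) (hP : IsProperPrimeIdeal P)
    (u v : L) (hu : 0 ≤ u) (hv : 0 ≤ v)
    (hu' : t.toFun (u - t.toFun u) ∉ P) (hv' : t.toFun (v - t.toFun v) ∉ P)
    (f : L) :
    (∀ α : ℝ, ((f - α • t.toFun u) ⊔ 0 ∈ P ↔ (f - α • t.toFun v) ⊔ 0 ∈ P)) ∧
      {α : ℝ | (f - α • t.toFun u) ⊔ 0 ∈ P} = {α : ℝ | (f - α • t.toFun v) ⊔ 0 ∈ P} := by
  have h (α : ℝ) : (f - α • t.toFun u) ⊔ 0 ∈ P ↔ (f - α • t.toFun v) ⊔ 0 ∈ P := by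
    refine hP.1.sup_mem_iff_of_sub_mem ?_
    rw [sub_sub_sub_cancel_left, ← smul_sub]
    exact P.smul_mem α (t.sub_mem hP hu hv hu' hv')
  exact ⟨h, Set.ext h⟩
end

section
/- Let L be an Archimedean vector lattice and let T be a multi-truncation on L. Then T is maximal if and only if for every f ∈ L with f > 0 there exists a truncation * ∈ T such that f* > 0. -/
/-- A multi-truncation on `L`: a family of truncations with pairwise disjoint ranges. -/
def IsMultiTruncation {L : Type*} [Lattice L] [AddCommGroup L]
    (T : Set (Truncation L)) : Prop :=
  ∀ s ∈ T, ∀ r ∈ T, s ≠ r → ∀ f : L, 0 ≤ f → s.toFun f ⊓ r.toFun f = 0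

namespace Truncation

variable {L : Type*} [Lattice L] [AddCommGroup L]

/-- In an Archimedean lattice-ordered group, meeting with a fixed positive element `e` is a
truncation. -/
def infRight (arch : ∀ f g : L, 0 ≤ f → 0 ≤ g → (∀ n : ℕ, 1 ≤ n → n • f ≤ g) → f = 0)
    (e : L) (he : 0 < e) : Truncation L where
  toFun g := g ⊓ e
  map_nonneg' _ hg := le_inf hg he.le
  nonzero' := ⟨e, he.le, by simpa using he.ne'⟩
  inf_le' _ _ _ _ := inf_le_inf_left _ inf_le_right
  le_self' _ _ := inf_le_left
  arch' g hg h := arch g e hg he.le fun n hn => inf_eq_left.mp (h n hn)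

/-- A truncation fixes the elements of its range. -/
theorem toFun_toFun (s : Truncation L) {f : L} (hf : 0 ≤ f) :
    s.toFun (s.toFun f) = s.toFun f := by
  have hsf := s.map_nonneg' f hf
  exact le_antisymm (s.le_self' _ hsf) (by simpa using s.inf_le' _ f hsf hf)

/-- An element annihilated by a truncation is disjoint from the range of that truncation. -/
theorem inf_toFun_eq_zero (s : Truncation L) {e g : L} (he : 0 ≤ e) (hg : 0 ≤ g)
    (hse : s.toFun e = 0) : e ⊓ s.toFun g = 0 :=
  le_antisymm (hse ▸ s.inf_le' e g he hg) (le_inf he (s.map_nonneg' g hg))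

end Truncation

/-- Extending a multi-truncation by a truncation disjoint from all of its members. -/
theorem IsMultiTruncation.insert {L : Type*} [Lattice L] [AddCommGroup L]
    {T : Set (Truncation L)} (hT : IsMultiTruncation T) {r : Truncation L}
    (hr : ∀ s ∈ T, ∀ f : L, 0 ≤ f → r.toFun f ⊓ s.toFun f = 0) :
    IsMultiTruncation (insert r T) := by
  rintro s (rfl | hs) t (rfl | ht) hst f hf
  · exact absurd rfl hst
  · exact hr t ht f hf
  · rw [inf_comm]
    exact hr s hs f hf
  · exact hT s hs t ht hst f hf

/-- Let `L` be an Archimedean vector lattice and `T` a multi-truncation on `L`.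
Then `T` is maximal (i.e. not strictly contained in another multi-truncation) iff
for every `f ∈ L` with `f > 0` there exists `* ∈ T` with `f* > 0`. -/
theorem stmt_10 {L : Type*} [Lattice L] [AddCommGroup L]
    [CovariantClass L L (· + ·) (· ≤ ·)] [Module ℝ L] [PosSMulMono ℝ L]
    (arch : ∀ f g : L, 0 ≤ f → 0 ≤ g → (∀ n : ℕ, 1 ≤ n → n • f ≤ g) → f = 0)
    (T : Set (Truncation L)) (hT : IsMultiTruncation T) :
    (∀ T' : Set (Truncation L), IsMultiTruncation T' → T ⊆ T' → T' = T) ↔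
      (∀ f : L, 0 < f → ∃ s ∈ T, 0 < s.toFun f) := by
  constructor
  · intro hmax e he
    by_contra! hzero
    replace hzero : ∀ s ∈ T, s.toFun e = 0 := fun s hs =>
      ((s.map_nonneg' e he.le).eq_or_lt.resolve_right (hzero s hs)).symm
    let r := Truncation.infRight arch e he
    have hmulti : IsMultiTruncation (insert r T) := hT.insert fun s hs g hg => by
      change g ⊓ e ⊓ s.toFun g = 0
      rw [inf_assoc, s.inf_toFun_eq_zero he.le hg (hzero s hs), inf_eq_right.mpr hg]
    have hr : r ∈ T := hmax _ hmulti (Set.subset_insert r T) ▸ Set.mem_insert r T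
    have hre : e ⊓ e = 0 := hzero r hr
    exact he.ne' (by rwa [inf_idem] at hre)
  · intro hpos T' hT' hsub
    refine Set.Subset.antisymm (fun r hr => ?_) hsub
    by_contra hrT
    obtain ⟨f, hf, hrf⟩ := r.nonzero'
    have hrf_nonneg := r.map_nonneg' f hf
    obtain ⟨s, hs, hsrf⟩ := hpos (r.toFun f) (lt_of_le_of_ne hrf_nonneg hrf.symm)
    have hdisj := hT' s (hsub hs) r hr (fun h => hrT (h ▸ hs)) _ hrf_nonneg
    rw [r.toFun_toFun hf, inf_eq_left.mpr (s.le_self' _ hrf_nonneg)] at hdisj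
    exact hsrf.ne' hdisj
end

section
/- Every truncation on a vector lattice L is a member of some maximal multi-truncation on L. -/
theorem IsMultiTruncation.singleton {L : Type*} [Lattice L] [AddCommGroup L]
    (t : Truncation L) : IsMultiTruncation {t} := by
  rintro s rfl r rfl hne
  exact absurd rfl hne

theorem IsMultiTruncation.sUnion {L : Type*} [Lattice L] [AddCommGroup L]
    {c : Set (Set (Truncation L))} (hc : IsChain (· ⊆ ·) c)
    (h : ∀ T ∈ c, IsMultiTruncation T) : IsMultiTruncation (⋃₀ c) := by
  rintro s ⟨S, hS, hs⟩ r ⟨R, hR, hr⟩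
  rcases hc.total hS hR with hSR | hRS
  · exact h R hR s (hSR hs) r hr
  · exact h S hS s hs r (hRS hr)

/-- Every truncation on a vector lattice `L` is a member of some maximal
multi-truncation on `L`. -/
theorem stmt_11 {L : Type*} [Lattice L] [AddCommGroup L]
    [CovariantClass L L (· + ·) (· ≤ ·)] [Module ℝ L] [PosSMulMono ℝ L]
    (t : Truncation L) :
    ∃ T : Set (Truncation L), IsMultiTruncation T ∧ t ∈ T ∧
      ∀ T' : Set (Truncation L), IsMultiTruncation T' → T ⊆ T' → T' = T := by
  obtain ⟨T, htT, hT⟩ := zorn_subset_nonempty {T : Set (Truncation L) | IsMultiTruncation T}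
    (fun c hc hchain _ =>
      ⟨⋃₀ c, IsMultiTruncation.sUnion hchain hc, fun _ hs => Set.subset_sUnion_of_mem hs⟩)
    {t} (IsMultiTruncation.singleton t)
  exact ⟨T, hT.prop, htT rfl, fun T' hT' hTT' => (hT.eq_of_subset hT' hTT').symm⟩
end

section
/- Let T be a multi-truncation on a vector lattice L and let Q be a nonempty set of proper prime ideals of L. Then the family {Q* : * ∈ T} is a partition of Q_T: every P ∈ Q_T belongs to Q* for exactly one * ∈ T; moreover each Q* is both open and closed in Q_T equipped with the hull-kernel topology. -/
/-- The hull-kernel topology on a set `X` of ideals of `L`, generated by the sets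
`[X]_f = {P ∈ X : f ∉ P}` for `f ∈ L⁺`. -/
def hullKernel {L : Type*} [Lattice L] [AddCommGroup L] [Module ℝ L]
    (X : Set (Submodule ℝ L)) : TopologicalSpace X :=
  TopologicalSpace.generateFrom {S : Set X | ∃ f : L, 0 ≤ f ∧ S = {P : X | f ∉ P.1}}

/-- `Q* = ⋃_{f ∈ L⁺} [Q]_{f*}`, the set of `P ∈ Q` omitting `f*` for some `f ∈ L⁺`. -/
def Qstar {L : Type*} [Lattice L] [AddCommGroup L] [Module ℝ L]
    (Q : Set (Submodule ℝ L)) (t : Truncation L) : Set (Submodule ℝ L) :=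
  {P | P ∈ Q ∧ ∃ f : L, 0 ≤ f ∧ t.toFun f ∉ P}

/-- `Q_T = ⋃_{* ∈ T} Q*`. -/
def QT {L : Type*} [Lattice L] [AddCommGroup L] [Module ℝ L]
    (Q : Set (Submodule ℝ L)) (T : Set (Truncation L)) : Set (Submodule ℝ L) :=
  ⋃ t ∈ T, Qstar Q t

theorem Truncation.toFun_le_toFun {L : Type*} [Lattice L] [AddCommGroup L]
    (t : Truncation L) {f h : L} (hf : 0 ≤ f) (hfh : f ≤ h) : t.toFun f ≤ t.toFun h := by
  have hle : t.toFun f ≤ h := (t.le_self' f hf).trans hfh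
  simpa [inf_eq_right.mpr hle] using t.inf_le' h f (hf.trans hfh) hf

theorem IsMultiTruncation.inf_eq_zero {L : Type*} [Lattice L] [AddCommGroup L]
    {T : Set (Truncation L)} (hT : IsMultiTruncation T) {s r : Truncation L} (hs : s ∈ T)
    (hr : r ∈ T) (hsr : s ≠ r) {f g : L} (hf : 0 ≤ f) (hg : 0 ≤ g) :
    s.toFun f ⊓ r.toFun g = 0 := by
  refine le_antisymm ?_ (le_inf (s.map_nonneg' f hf) (r.map_nonneg' g hg))
  rw [← hT s hs r hr hsr (f ⊔ g) (hf.trans le_sup_left)]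
  exact inf_le_inf (s.toFun_le_toFun hf le_sup_left) (r.toFun_le_toFun hg le_sup_right)

theorem IsMultiTruncation.eq_of_mem_Qstar {L : Type*} [Lattice L] [AddCommGroup L] [Module ℝ L]
    {T : Set (Truncation L)} (hT : IsMultiTruncation T) {Q : Set (Submodule ℝ L)}
    (hQ : ∀ P ∈ Q, IsProperPrimeIdeal P) {s r : Truncation L} (hs : s ∈ T) (hr : r ∈ T)
    {P : Submodule ℝ L} (hPs : P ∈ Qstar Q s) (hPr : P ∈ Qstar Q r) : s = r := by
  by_contra hsr
  obtain ⟨hPQ, f, hf, hfP⟩ := hPs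
  obtain ⟨-, g, hg, hgP⟩ := hPr
  have hmem : s.toFun f ⊓ r.toFun g ∈ P := by
    rw [hT.inf_eq_zero hs hr hsr hf hg]
    exact P.zero_mem
  exact ((hQ P hPQ).2.2 _ _ hmem).elim hfP hgP

theorem isOpen_Qstar {L : Type*} [Lattice L] [AddCommGroup L] [Module ℝ L]
    {Q X : Set (Submodule ℝ L)} (hX : X ⊆ Q) (t : Truncation L) :
    @IsOpen _ (hullKernel X) {P : X | P.1 ∈ Qstar Q t} := by
  let := hullKernel X
  have hunion : {P : X | P.1 ∈ Qstar Q t} =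
      ⋃ f : {f : L // 0 ≤ f}, {P : X | t.toFun f.1 ∉ P.1} := by
    ext P
    simp [Qstar, hX P.2]
  rw [hunion]
  exact isOpen_iUnion fun f =>
    TopologicalSpace.isOpen_generateFrom_of_mem ⟨t.toFun f.1, t.map_nonneg' _ f.2, rfl⟩

theorem QT_subset {L : Type*} [Lattice L] [AddCommGroup L] [Module ℝ L]
    (Q : Set (Submodule ℝ L)) (T : Set (Truncation L)) : QT Q T ⊆ Q :=
  Set.iUnion₂_subset fun _ _ _ hP => hP.1

/-- Let `T` be a multi-truncation on a vector lattice `L` and `Q` a nonempty set of proper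
prime ideals of `L`. Then `{Q* : * ∈ T}` is a partition of `Q_T`: every `P ∈ Q_T` belongs
to `Q*` for exactly one `* ∈ T`, and each `Q*` is open and closed in `Q_T` with the
hull-kernel topology. -/
theorem stmt_12 {L : Type*} [Lattice L] [AddCommGroup L]
    [CovariantClass L L (· + ·) (· ≤ ·)] [Module ℝ L] [PosSMulMono ℝ L]
    (T : Set (Truncation L)) (hT : IsMultiTruncation T)
    (Q : Set (Submodule ℝ L)) (hQne : Q.Nonempty)
    (hQ : ∀ P ∈ Q, IsProperPrimeIdeal P) :
    (∀ P ∈ QT Q T, ∃! t : Truncation L, t ∈ T ∧ P ∈ Qstar Q t) ∧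
      (∀ t ∈ T,
        @IsOpen _ (hullKernel (QT Q T)) {P : QT Q T | P.1 ∈ Qstar Q t} ∧
        @IsClosed _ (hullKernel (QT Q T)) {P : QT Q T | P.1 ∈ Qstar Q t}) := by
  have hcover : ∀ P ∈ QT Q T, ∃ t ∈ T, P ∈ Qstar Q t := fun P hP => by
    simpa [QT] using hP
  refine ⟨fun P hP => ?_, fun t ht => ⟨isOpen_Qstar (QT_subset Q T) t, ?_⟩⟩
  · obtain ⟨t, ht, hPt⟩ := hcover P hP
    exact ⟨t, ⟨ht, hPt⟩, fun r hr => hT.eq_of_mem_Qstar hQ hr.1 ht hr.2 hPt⟩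
  · let := hullKernel (QT Q T)
    have hcompl : {P : QT Q T | P.1 ∈ Qstar Q t}ᶜ =
        ⋃ r ∈ T \ {t}, {P : QT Q T | P.1 ∈ Qstar Q r} := by
      ext P
      simp only [Set.mem_compl_iff, Set.mem_ofPred_eq, Set.mem_iUnion, exists_prop]
      constructor
      · intro hP
        obtain ⟨r, hr, hPr⟩ := hcover P.1 P.2
        exact ⟨r, ⟨hr, fun hrt => hP (hrt ▸ hPr)⟩, hPr⟩
      · rintro ⟨r, ⟨hr, hrt⟩, hPr⟩ hPt
        exact hrt (hT.eq_of_mem_Qstar hQ hr ht hPr hPt)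
    rw [← isOpen_compl_iff, hcompl]
    exact isOpen_biUnion fun r _ => isOpen_Qstar (QT_subset Q T) r
end

section
/- Let L be an Archimedean vector lattice, T a maximal multi-truncation on L, and V = ⋃_{* ∈ T} ⋃_{f ∈ L⁺} Val(f*). Then ⋂_{P ∈ V} P = {0}; that is, if f ∈ L belongs to every ideal P ∈ V, then f = 0 (equivalently, V is dense in the set of all proper prime ideals of L with the hull-kernel topology). -/
/-- `P` is a value of `h`: an ideal of `L` maximal with respect to not containing `h`. -/
def IsValue {L : Type*} [Lattice L] [AddCommGroup L] [Module ℝ L]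
    (P : Submodule ℝ L) (h : L) : Prop :=
  IsLatticeIdeal P ∧ h ∉ P ∧
    ∀ Q : Submodule ℝ L, IsLatticeIdeal Q → P ≤ Q → h ∉ Q → Q = P

/-- The spectrum `𝒱 = ⋃_{* ∈ T} ⋃_{f ∈ L⁺} Val(f*)` of `L` with respect to a
multi-truncation `T`. -/
def ValSet {L : Type*} [Lattice L] [AddCommGroup L] [Module ℝ L]
    (T : Set (Truncation L)) : Set (Submodule ℝ L) :=
  {P | ∃ t ∈ T, ∃ f : L, 0 ≤ f ∧ IsValue P (t.toFun f)}

/-- Every nonzero element of a vector lattice has a value. -/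
theorem exists_isValue {L : Type*} [Lattice L] [AddCommGroup L] [AddLeftMono L] [Module ℝ L]
    {h : L} (hh : h ≠ 0) : ∃ P : Submodule ℝ L, IsValue P h := by
  obtain ⟨P, -, hP⟩ := zorn_le_nonempty₀
    {P : Submodule ℝ L | IsLatticeIdeal P ∧ h ∉ P} (fun c hc hchain y hy => by
      have hdir : DirectedOn (· ≤ ·) c := hchain.directedOn
      refine ⟨sSup c, ⟨fun f hf g hg => ?_, fun hmem => ?_⟩, fun z hz => le_sSup hz⟩
      · obtain ⟨Q, hQ, hfQ⟩ := (Submodule.mem_sSup_of_directed ⟨y, hy⟩ hdir).1 hf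
        exact le_sSup hQ ((hc hQ).1 f hfQ g hg)
      · obtain ⟨Q, hQ, hhQ⟩ := (Submodule.mem_sSup_of_directed ⟨y, hy⟩ hdir).1 hmem
        exact (hc hQ).2 hhQ) ⊥
    ⟨fun f hf g hg => by
      rw [Submodule.mem_bot] at hf ⊢
      rw [hf, abs_zero] at hg
      exact le_antisymm ((le_abs_self g).trans hg)
        (neg_nonpos.1 ((neg_le_abs g).trans hg)), by simpa using hh⟩
  exact ⟨P, hP.prop.1, hP.prop.2, fun Q hQ hPQ hhQ => (hP.eq_of_le ⟨hQ, hhQ⟩ hPQ).symm⟩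

/-- An element lying below some value of a truncation is fixed by it. -/
theorem Truncation.toFun_eq_self {L : Type*} [Lattice L] [AddCommGroup L] (t : Truncation L)
    {k g : L} (hk : 0 ≤ k) (hg : 0 ≤ g) (hkg : k ≤ t.toFun g) : t.toFun k = k :=
  le_antisymm (t.le_self' k hk) (by simpa [inf_eq_left.2 hkg] using t.inf_le' k g hk hg)

/-- In an Archimedean lattice-ordered group, meeting with a nonzero positive element is a
truncation. -/
def Truncation.infRight_s16 {L : Type*} [Lattice L] [AddCommGroup L]
    (arch : ∀ f g : L, 0 ≤ f → 0 ≤ g → (∀ n : ℕ, 1 ≤ n → n • f ≤ g) → f = 0)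
    (h : L) (h0 : 0 ≤ h) (hne : h ≠ 0) : Truncation L where
  toFun f := f ⊓ h
  map_nonneg' _ hf := le_inf hf h0
  nonzero' := ⟨h, h0, by simpa using hne⟩
  inf_le' _ _ _ _ := inf_le_inf_left _ inf_le_right
  le_self' _ _ := inf_le_left
  arch' f hf hn := arch f h hf h0 fun n hn1 => inf_eq_left.1 (hn n hn1)

/-- Let `L` be an Archimedean vector lattice, `T` a maximal multi-truncation on `L`, and
`𝒱 = ⋃_{* ∈ T} ⋃_{f ∈ L⁺} Val(f*)`. Then `⋂_{P ∈ 𝒱} P = {0}`: if `f ∈ L` belongs to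
every `P ∈ 𝒱`, then `f = 0`. -/
theorem stmt_16 {L : Type*} [Lattice L] [AddCommGroup L]
    [CovariantClass L L (· + ·) (· ≤ ·)] [Module ℝ L] [PosSMulMono ℝ L]
    (arch : ∀ f g : L, 0 ≤ f → 0 ≤ g → (∀ n : ℕ, 1 ≤ n → n • f ≤ g) → f = 0)
    (T : Set (Truncation L)) (hT : IsMultiTruncation T)
    (hmax : ∀ T' : Set (Truncation L), IsMultiTruncation T' → T ⊆ T' → T' = T) :
    ∀ f : L, (∀ P ∈ ValSet T, f ∈ P) → f = 0 := by
  intro f hf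
  have : AddLeftMono L := ‹CovariantClass L L (· + ·) (· ≤ ·)›
  have hdisj : ∀ t ∈ T, ∀ g : L, 0 ≤ g → |f| ⊓ t.toFun g = 0 := by
    intro t ht g hg
    by_contra hne
    have hk : 0 ≤ |f| ⊓ t.toFun g := le_inf (abs_nonneg f) (t.map_nonneg' g hg)
    obtain ⟨P, hP⟩ := exists_isValue hne
    have hfP : f ∈ P := hf P ⟨t, ht, _, hk, by rwa [t.toFun_eq_self hk hg inf_le_right]⟩
    exact hP.2.1 (hP.1 f hfP _ ((abs_of_nonneg hk).trans_le inf_le_left))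
  by_contra hne
  have habs : |f| ≠ 0 := fun h0 => hne <| le_antisymm ((le_abs_self f).trans h0.le)
    (neg_nonpos.1 ((neg_le_abs f).trans h0.le))
  let r := Truncation.infRight_s16 arch |f| (abs_nonneg f) habs
  have hr : ∀ t ∈ T, ∀ g : L, 0 ≤ g → r.toFun g ⊓ t.toFun g = 0 := fun t ht g hg =>
    le_antisymm ((inf_le_inf_right _ inf_le_right).trans (hdisj t ht g hg).le)
      (le_inf (r.map_nonneg' g hg) (t.map_nonneg' g hg))
  have hmulti : IsMultiTruncation (insert r T) := by
    rintro s (rfl | hs) t (rfl | ht) hst g hg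
    · exact absurd rfl hst
    · exact hr t ht g hg
    · rw [inf_comm]
      exact hr s hs g hg
    · exact hT s hs t ht hst g hg
  have hrT : r ∈ T := hmax _ hmulti (Set.subset_insert r T) ▸ Set.mem_insert r T
  exact habs (by simpa [r, Truncation.infRight_s16] using hdisj r hrT |f| (abs_nonneg f))
end
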